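/- Let κ satisfy the energy, consistency, and domination principles. Then for every μ ∈ E⁺ and every set A ⊂ X, the inner balayage μ^A exists: there is a measure μ^A ∈ Λ_{A,μ} such that κμ^A ≤ κν everywhere on X for all ν ∈ Λ_{A,μ}. Moreover, μ^A satisfies: κμ^A = κμ nearly everywhere on A; κμ^A = κμ μ^A-almost everywhere; and κμ^A ≤ κμ everywhere on X. -/

import Mathlib

open MeasureTheory Filter Topology Set
open scoped ENNReal NNReal

namespace Balayage

variable {X : Type*} [TopologicalSpace X] [T2Space X] [LocallyCompactSpace X]
  [MeasurableSpace X] [BorelSpace X]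

/-- The potential `κμ(x) := ∫ κ(x,y) dμ(y)`. -/
noncomputable def pot (κ : X → X → ℝ≥0∞) (μ : Measure X) (x : X) : ℝ≥0∞ :=
  ∫⁻ y, κ x y ∂μ

/-- The mutual energy `κ(μ,ν) := ∬ κ(x,y) d(μ⊗ν)(x,y)`. -/
noncomputable def energy (κ : X → X → ℝ≥0∞) (μ ν : Measure X) : ℝ≥0∞ :=
  ∫⁻ x, pot κ ν x ∂μ

/-- A positive Radon measure: locally finite and inner regular. -/
def IsRadon (μ : Measure X) : Prop :=
  μ.InnerRegular ∧ IsLocallyFiniteMeasure μ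

/-- `E⁺`: the positive Radon measures of finite energy. -/
def Eplus (κ : X → X → ℝ≥0∞) : Set (Measure X) :=
  {μ | IsRadon μ ∧ energy κ μ μ < ⊤}

/-- `μ` is concentrated on `A`: `A` is `μ`-measurable and `X∖A` is locally `μ`-negligible. -/
def ConcOn (μ : Measure X) (A : Set X) : Prop :=
  NullMeasurableSet A μ ∧ ∀ K : Set X, IsCompact K → μ (Aᶜ ∩ K) = 0

/-- `E⁺_A`: measures of finite energy concentrated on `A`. -/
def EplusOn (κ : X → X → ℝ≥0∞) (A : Set X) : Set (Measure X) :=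
  {μ ∈ Eplus κ | ConcOn μ A}

/-- The inner capacity `c_*(A)`. -/
noncomputable def innerCap (κ : X → X → ℝ≥0∞) (A : Set X) : ℝ≥0∞ :=
  (⨅ μ ∈ {μ ∈ EplusOn κ A | μ Set.univ = 1}, energy κ μ μ)⁻¹

/-- `P` holds nearly everywhere on `A`: the set where it fails has inner capacity zero. -/
def NEOn (κ : X → X → ℝ≥0∞) (A : Set X) (P : X → Prop) : Prop :=
  innerCap κ {x | x ∈ A ∧ ¬ P x} = 0

/-- The outer capacity `c^*(A)`. -/
noncomputable def outerCap (κ : X → X → ℝ≥0∞) (A : Set X) : ℝ≥0∞ :=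
  ⨅ D ∈ {D : Set X | IsOpen D ∧ A ⊆ D}, innerCap κ D

/-- `P` holds quasi-everywhere on `A`: the set where it fails has outer capacity zero. -/
def QEOn (κ : X → X → ℝ≥0∞) (A : Set X) (P : X → Prop) : Prop :=
  outerCap κ {x | x ∈ A ∧ ¬ P x} = 0

/-- The class `Λ_{A,μ}` of measures `ν ∈ E⁺` with `κν ≥ κμ` n.e. on `A`. -/
def InnerLam (κ : X → X → ℝ≥0∞) (A : Set X) (μ : Measure X) : Set (Measure X) :=
  {ν ∈ Eplus κ | NEOn κ A (fun x => pot κ μ x ≤ pot κ ν x)}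

/-- The class `Λ*_{A,μ}` of measures `ν ∈ E⁺` with `κν ≥ κμ` q.e. on `A`. -/
def OuterLam (κ : X → X → ℝ≥0∞) (A : Set X) (μ : Measure X) : Set (Measure X) :=
  {ν ∈ Eplus κ | QEOn κ A (fun x => pot κ μ x ≤ pot κ ν x)}

/-- `b` is the inner balayage `μ^A`: the measure of minimal potential in `Λ_{A,μ}`. -/
def IsInnerBal (κ : X → X → ℝ≥0∞) (A : Set X) (μ b : Measure X) : Prop :=
  b ∈ InnerLam κ A μ ∧ ∀ ν ∈ InnerLam κ A μ, ∀ x, pot κ b x ≤ pot κ ν x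

/-- `b` is the outer balayage `μ^{*A}`: the measure of minimal potential in `Λ*_{A,μ}`. -/
def IsOuterBal (κ : X → X → ℝ≥0∞) (A : Set X) (μ b : Measure X) : Prop :=
  b ∈ OuterLam κ A μ ∧ ∀ ν ∈ OuterLam κ A μ, ∀ x, pot κ b x ≤ pot κ ν x

/-- The strong (energy) distance `‖μ − ν‖`. -/
noncomputable def strDist (κ : X → X → ℝ≥0∞) (μ ν : Measure X) : ℝ :=
  Real.sqrt ((energy κ μ μ).toReal - 2 * (energy κ μ ν).toReal + (energy κ ν ν).toReal)

/-- The energy principle (strict positive definiteness). -/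
def EnergyPrinciple (κ : X → X → ℝ≥0∞) : Prop :=
  ∀ μ ∈ Eplus κ, ∀ ν ∈ Eplus κ,
    2 * energy κ μ ν ≤ energy κ μ μ + energy κ ν ν ∧
      (2 * energy κ μ ν = energy κ μ μ + energy κ ν ν → μ = ν)

/-- Vague convergence of a net of measures along a filter. -/
def VagueConv {ι : Type*} (F : Filter ι) (m : ι → Measure X) (ν : Measure X) : Prop :=
  ∀ f : X → ℝ, Continuous f → HasCompactSupport f →
    Tendsto (fun i => ∫ x, f x ∂(m i)) F (nhds (∫ x, f x ∂ν))

/-- A net of measures is strong Cauchy (for the energy metric) along a filter. -/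
def StrongCauchy (κ : X → X → ℝ≥0∞) {ι : Type*} (F : Filter ι) (m : ι → Measure X) : Prop :=
  ∀ ε : ℝ, 0 < ε → ∃ s ∈ F, ∀ i ∈ s, ∀ j ∈ s, strDist κ (m i) (m j) < ε

/-- The consistency principle: every strong Cauchy net in `E⁺` converges strongly
to each of its vague limit points. -/
def Consistent (κ : X → X → ℝ≥0∞) : Prop :=
  ∀ (ι : Type) (F : Filter ι) (m : ι → Measure X), F.NeBot →
    (∀ i, m i ∈ Eplus κ) → StrongCauchy κ F m →
    ∀ ν : Measure X, (∃ G : Filter ι, G ≤ F ∧ G.NeBot ∧ VagueConv G m ν) →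
      Tendsto (fun i => strDist κ (m i) ν) F (nhds 0)

/-- The domination principle. -/
def Domination (κ : X → X → ℝ≥0∞) : Prop :=
  ∀ μ ∈ Eplus κ, ∀ ν ∈ Eplus κ,
    (∀ᵐ x ∂μ, pot κ μ x ≤ pot κ ν x) → ∀ x, pot κ μ x ≤ pot κ ν x

/-- A kernel: symmetric and lower semicontinuous. -/
structure IsKernel (κ : X → X → ℝ≥0∞) : Prop where
  symm : ∀ x y, κ x y = κ y x
  lsc : LowerSemicontinuous (Function.uncurry κ)

/-- `E'_A`: the strong closure of `E⁺_A` within `E⁺`. -/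
def EclosOn (κ : X → X → ℝ≥0∞) (A : Set X) : Set (Measure X) :=
  {ν ∈ Eplus κ | ∀ ε : ℝ, 0 < ε → ∃ μ ∈ EplusOn κ A, strDist κ ν μ < ε}

/-- The (real-valued) potential of the signed measure `λ = lp − lm`. -/
noncomputable def spot (κ : X → X → ℝ≥0∞) (lp lm : Measure X) (x : X) : ℝ :=
  (pot κ lp x).toReal - (pot κ lm x).toReal

/-- Assumption (A2): every `f ∈ C_c(X)` is the limit, uniformly with supports in one fixed
compact set, of a sequence of potentials of signed measures of finite energy that are
continuous and compactly supported. -/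
def A2 (κ : X → X → ℝ≥0∞) : Prop :=
  ∀ f : X → ℝ, Continuous f → HasCompactSupport f →
    ∃ (K : Set X) (lp lm : ℕ → Measure X), IsCompact K ∧ tsupport f ⊆ K ∧
      (∀ j, lp j ∈ Eplus κ ∧ lm j ∈ Eplus κ) ∧
      (∀ j x, pot κ (lp j) x ≠ ⊤ ∨ pot κ (lm j) x ≠ ⊤) ∧
      (∀ j, Continuous (spot κ (lp j) (lm j))) ∧
      (∀ j, tsupport (spot κ (lp j) (lm j)) ⊆ K) ∧
      TendstoUniformly (fun j => spot κ (lp j) (lm j)) f atTop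


set_option linter.unusedSectionVars false

section LowerSemicontinuous

variable {Y : Type*} [TopologicalSpace Y]

/-- Monotone convergence for a directed family of lower semicontinuous functions and an inner
regular measure; the family need not be countable. -/
theorem lintegral_iSup_of_directed_of_lowerSemicontinuous [MeasurableSpace Y] [BorelSpace Y]
    {ι : Type*} [Nonempty ι] (μ : Measure Y) [μ.InnerRegular] {f : ι → Y → ℝ≥0∞}
    (hf : ∀ i, LowerSemicontinuous (f i)) (hd : Directed (· ≤ ·) f) :
    ∫⁻ x, ⨆ i, f i x ∂μ = ⨆ i, ∫⁻ x, f i x ∂μ := by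
  refine le_antisymm ?_ (iSup_lintegral_le _)
  rw [lintegral_eq_nnreal]
  refine iSup_le fun s => iSup_le fun hsf => ?_
  refine ENNReal.le_of_forall_lt_one_mul_le fun a ha => ?_
  obtain ⟨r, rfl, -⟩ := ENNReal.lt_iff_exists_coe.1 ha
  have ha : r < 1 := ENNReal.coe_lt_coe.1 ha
  set c : ℝ≥0 → ℝ≥0∞ := fun x => (x : ℝ≥0∞)
  let rs := s.map fun a => r * a
  have eq_rs : rs.map c = (SimpleFunc.const Y r : SimpleFunc Y ℝ≥0∞) * s.map c := by
    ext x; simp [rs, c]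
  have key : ∀ p, μ (rs.map c ⁻¹' {p}) = ⨆ i, μ (rs.map c ⁻¹' {p} ∩ {x | p ≤ f i x}) := by
    intro p
    refine le_antisymm ?_ (iSup_le fun i => measure_mono inter_subset_left)
    refine le_of_forall_lt fun q hq => ?_
    obtain ⟨K, hKS, hK, hqK⟩ :=
      (SimpleFunc.measurableSet_fiber (rs.map c) p).exists_lt_isCompact hq
    by_cases p_eq : p = 0
    · obtain ⟨i⟩ := ‹Nonempty ι›
      refine hq.trans_le (le_iSup_of_le i (measure_mono fun x hx => ⟨hx, ?_⟩))
      simp [p_eq]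
    obtain ⟨i, hi⟩ : ∃ i, K ⊆ {x | p < f i x} := by
      refine hK.elim_directed_cover _ (fun i => (hf i).isOpen_preimage p) (fun x hx => ?_)
        (fun i j => ?_)
      · have hx' : (rs.map c) x = p := hKS hx
        subst hx'
        have h1 : r * s x ≠ 0 := by
          intro h; apply p_eq; simp [rs, c, h]
        have h2 : s x ≠ 0 := right_ne_zero_of_mul h1
        have : (rs.map c) x < ⨆ i, f i x := by
          refine lt_of_lt_of_le (ENNReal.coe_lt_coe.2 ?_) (hsf x)
          suffices r * s x < 1 * s x by simpa
          gcongr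
        obtain ⟨i, hi⟩ := lt_iSup_iff.1 this
        exact mem_iUnion.2 ⟨i, hi⟩
      · obtain ⟨k, hik, hjk⟩ := hd i j
        exact ⟨k, fun x hx => lt_of_lt_of_le hx (hik x), fun x hx => lt_of_lt_of_le hx (hjk x)⟩
    exact hqK.trans_le (le_iSup_of_le i (measure_mono fun x hx =>
      ⟨hKS hx, le_of_lt (show p < f i x from hi hx)⟩))
  have h_meas : ∀ i, MeasurableSet {x | rs.map c x ≤ f i x} := fun i =>
    measurableSet_le (SimpleFunc.measurable _) (hf i).measurable
  calc
    (r : ℝ≥0∞) * (s.map c).lintegral μ = ∑ p ∈ (rs.map c).range, p * μ (rs.map c ⁻¹' {p}) := by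
      rw [← SimpleFunc.const_mul_lintegral, ← SimpleFunc.lintegral, eq_rs]
    _ = ∑ p ∈ (rs.map c).range, ⨆ i, p * μ (rs.map c ⁻¹' {p} ∩ {x | p ≤ f i x}) :=
      Finset.sum_congr rfl fun p _ => by rw [key p, ENNReal.mul_iSup]
    _ = ⨆ i, ∑ p ∈ (rs.map c).range, p * μ (rs.map c ⁻¹' {p} ∩ {x | p ≤ f i x}) := by
      refine ENNReal.finsetSum_iSup fun i j => ?_
      obtain ⟨k, hik, hjk⟩ := hd i j
      refine ⟨k, fun p => ⟨?_, ?_⟩⟩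
      · gcongr _ * μ ?_
        exact fun x hx => ⟨hx.1, le_trans hx.2 (hik x)⟩
      · gcongr _ * μ ?_
        exact fun x hx => ⟨hx.1, le_trans hx.2 (hjk x)⟩
    _ ≤ ⨆ i, ((rs.map c).restrict {x | (rs.map c) x ≤ f i x}).lintegral μ := by
      gcongr with i
      rw [SimpleFunc.restrict_lintegral _ (h_meas i)]
      refine le_of_eq (Finset.sum_congr rfl fun p _ => ?_)
      congr 2 with x
      refine and_congr_right ?_
      simp +contextual
    _ ≤ ⨆ i, ∫⁻ x, f i x ∂μ := by
      simp only [← SimpleFunc.lintegral_eq_lintegral]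
      gcongr with i x
      simp only [SimpleFunc.restrict_apply _ (h_meas _)]
      exact indicator_apply_le id

/-- The nonnegative, continuous, compactly supported minorants of `h`. -/
abbrev CcMinorant (h : Y → ℝ≥0∞) : Type _ :=
  {f : Y → ℝ // Continuous f ∧ HasCompactSupport f ∧ 0 ≤ f ∧ ∀ x, ENNReal.ofReal (f x) ≤ h x}

namespace CcMinorant

instance (h : Y → ℝ≥0∞) : Nonempty (CcMinorant h) :=
  ⟨⟨0, continuous_zero, HasCompactSupport.zero, le_rfl, fun x => by simp⟩⟩

theorem directed (h : Y → ℝ≥0∞) :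
    Directed (· ≤ ·) fun (f : CcMinorant h) x => ENNReal.ofReal (f.1 x) := by
  rintro ⟨f, hf, hfc, hf0, hfh⟩ ⟨g, hg, hgc, hg0, hgh⟩
  refine ⟨⟨f ⊔ g, hf.sup hg, ?_, le_sup_of_le_left hf0, fun x => ?_⟩, fun x => ?_, fun x => ?_⟩
  · exact hfc.sup hgc
  · simp only [Pi.sup_apply]
    rcases le_total (f x) (g x) with h1 | h1
    · rw [sup_of_le_right h1]; exact hgh x
    · rw [sup_of_le_left h1]; exact hfh x
  · exact ENNReal.ofReal_le_ofReal le_sup_left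
  · exact ENNReal.ofReal_le_ofReal le_sup_right

theorem iSup_eq [T2Space Y] [LocallyCompactSpace Y] {h : Y → ℝ≥0∞}
    (hh : LowerSemicontinuous h) (x : Y) :
    ⨆ f : CcMinorant h, ENNReal.ofReal (f.1 x) = h x := by
  refine le_antisymm (iSup_le fun f => f.2.2.2.2 x) (le_of_forall_lt fun c hc => ?_)
  obtain ⟨d, hcd, hdh⟩ := ENNReal.lt_iff_exists_nnreal_btwn.1 hc
  have hU : IsOpen {y | (d : ℝ≥0∞) < h y} := hh.isOpen_preimage d
  obtain ⟨f, hf1, hf0, hfc, hf⟩ := exists_continuous_one_zero_of_isCompact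
    (isCompact_singleton (x := x)) hU.isClosed_compl (by simpa using hdh)
  refine hcd.trans_le (le_iSup_of_le ⟨fun y => d * f y, by fun_prop, hfc.mul_left,
    fun y => mul_nonneg d.2 (hf y).1, fun y => ?_⟩ ?_)
  · by_cases hy : (d : ℝ≥0∞) < h y
    · refine le_trans ?_ hy.le
      calc ENNReal.ofReal (d * f y) ≤ ENNReal.ofReal (d : ℝ) :=
            ENNReal.ofReal_le_ofReal (mul_le_of_le_one_right d.2 (hf y).2)
        _ = d := ENNReal.ofReal_coe_nnreal
    · have : f y = 0 := hf0 hy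
      simp [this]
  · have : f x = 1 := hf1 rfl
    simp [this]

end CcMinorant

theorem lintegral_eq_iSup_ccMinorant [T2Space Y] [LocallyCompactSpace Y] [MeasurableSpace Y]
    [BorelSpace Y] (μ : Measure Y) [μ.InnerRegular] {h : Y → ℝ≥0∞}
    (hh : LowerSemicontinuous h) :
    ∫⁻ x, h x ∂μ = ⨆ f : CcMinorant h, ∫⁻ x, ENNReal.ofReal (f.1 x) ∂μ := by
  refine Eq.trans (lintegral_congr fun x => (CcMinorant.iSup_eq hh x).symm) ?_
  exact lintegral_iSup_of_directed_of_lowerSemicontinuous μ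
    (fun f => (ENNReal.continuous_ofReal.comp f.2.1).lowerSemicontinuous) (CcMinorant.directed h)

theorem ofReal_integral_of_cc [MeasurableSpace Y] [BorelSpace Y] (μ : Measure Y)
    [IsFiniteMeasureOnCompacts μ] {f : Y → ℝ} (hf : Continuous f) (hfc : HasCompactSupport f)
    (hf0 : 0 ≤ f) : ENNReal.ofReal (∫ x, f x ∂μ) = ∫⁻ x, ENNReal.ofReal (f x) ∂μ :=
  ofReal_integral_eq_lintegral_ofReal (hf.integrable_of_hasCompactSupport hfc)
    (Eventually.of_forall hf0)

end LowerSemicontinuous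

section Potential

theorem hasCompactSupport_section {F : X × X → ℝ} (hF : HasCompactSupport F) (x : X) :
    HasCompactSupport fun y => F (x, y) := by
  refine HasCompactSupport.intro (hF.isCompact.image continuous_snd) fun y hy => ?_
  contrapose! hy
  exact ⟨(x, y), subset_tsupport _ hy, rfl⟩

theorem continuous_integral_section {F : X × X → ℝ} (hF : Continuous F)
    (hFc : HasCompactSupport F) (ν : Measure X) [IsFiniteMeasureOnCompacts ν] :
    Continuous fun x => ∫ y, F (x, y) ∂ν := by
  rw [← continuousOn_univ]
  refine continuousOn_integral_of_compact_support (f := fun x y => F (x, y))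
    (hFc.isCompact.image continuous_snd) hF.continuousOn fun x y _ hy => ?_
  contrapose! hy
  exact ⟨(x, y), subset_tsupport _ hy, rfl⟩

theorem hasCompactSupport_integral_section {F : X × X → ℝ}
    (hFc : HasCompactSupport F) (ν : Measure X) :
    HasCompactSupport fun x => ∫ y, F (x, y) ∂ν := by
  refine HasCompactSupport.intro (hFc.isCompact.image continuous_fst) fun x hx => ?_
  have : ∀ y, F (x, y) = 0 := fun y => by
    contrapose! hx
    exact ⟨(x, y), subset_tsupport _ hx, rfl⟩
  simp [this]

variable {κ : X → X → ℝ≥0∞}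

theorem IsRadon.isFiniteMeasureOnCompacts {μ : Measure X} (h : IsRadon μ) :
    IsFiniteMeasureOnCompacts μ :=
  have := h.2
  inferInstance

theorem IsKernel.lsc_section (hker : IsKernel κ) (x : X) : LowerSemicontinuous (κ x) :=
  hker.lsc.comp (continuous_const.prodMk continuous_id : Continuous fun y : X => (x, y))

theorem pot_eq_iSup (hker : IsKernel κ) {μ : Measure X} (hμ : IsRadon μ) (x : X) :
    pot κ μ x =
      ⨆ F : CcMinorant (Function.uncurry κ), ENNReal.ofReal (∫ y, F.1 (x, y) ∂μ) := by
  have := hμ.1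
  have := hμ.isFiniteMeasureOnCompacts
  calc pot κ μ x
      = ∫⁻ y, ⨆ F : CcMinorant (Function.uncurry κ), ENNReal.ofReal (F.1 (x, y)) ∂μ :=
        lintegral_congr fun y => (CcMinorant.iSup_eq hker.lsc (x, y)).symm
    _ = ⨆ F : CcMinorant (Function.uncurry κ), ∫⁻ y, ENNReal.ofReal (F.1 (x, y)) ∂μ := by
        refine lintegral_iSup_of_directed_of_lowerSemicontinuous μ (fun F => ?_) fun F G => ?_
        · exact (ENNReal.continuous_ofReal.comp
            (F.2.1.comp (Continuous.prodMk_right x))).lowerSemicontinuous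
        · obtain ⟨H, h1, h2⟩ := CcMinorant.directed (Function.uncurry κ) F G
          exact ⟨H, fun y => h1 (x, y), fun y => h2 (x, y)⟩
    _ = _ := iSup_congr fun F => (ofReal_integral_of_cc μ (by have := F.2.1; fun_prop)
        (hasCompactSupport_section F.2.2.1 x) fun y => F.2.2.2.1 (x, y)).symm

theorem directed_ofReal_integral_section (μ : Measure X) [IsFiniteMeasureOnCompacts μ] :
    Directed (· ≤ ·) fun (F : CcMinorant (Function.uncurry κ)) (x : X) =>
      ENNReal.ofReal (∫ y, F.1 (x, y) ∂μ) := by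
  intro F G
  obtain ⟨H, h1, h2⟩ := CcMinorant.directed (Function.uncurry κ) F G
  have key : ∀ F' : CcMinorant (Function.uncurry κ), ∀ x, ENNReal.ofReal (∫ y, F'.1 (x, y) ∂μ) =
      ∫⁻ y, ENNReal.ofReal (F'.1 (x, y)) ∂μ := fun F' x =>
    ofReal_integral_of_cc μ (by have := F'.2.1; fun_prop)
        (hasCompactSupport_section F'.2.2.1 x) fun y => F'.2.2.2.1 (x, y)
  refine ⟨H, fun x => ?_, fun x => ?_⟩ <;> simp only [key]
  · exact lintegral_mono fun y => h1 (x, y)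
  · exact lintegral_mono fun y => h2 (x, y)

theorem pot_lowerSemicontinuous (hker : IsKernel κ) {μ : Measure X} (hμ : IsRadon μ) :
    LowerSemicontinuous (pot κ μ) := by
  have := hμ.isFiniteMeasureOnCompacts
  rw [show pot κ μ = _ from funext (pot_eq_iSup hker hμ)]
  exact lowerSemicontinuous_iSup fun F => (ENNReal.continuous_ofReal.comp
    (continuous_integral_section F.2.1 F.2.2.1 μ)).lowerSemicontinuous

theorem pot_measurable (hker : IsKernel κ) {μ : Measure X} (hμ : IsRadon μ) :
    Measurable (pot κ μ) :=
  (pot_lowerSemicontinuous hker hμ).measurable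

theorem energy_le_energy_swap (hker : IsKernel κ) {μ ν : Measure X} (hμ : IsRadon μ)
    (hν : IsRadon ν) : energy κ μ ν ≤ energy κ ν μ := by
  have := hμ.1
  have := hμ.isFiniteMeasureOnCompacts
  have := hν.isFiniteMeasureOnCompacts
  calc energy κ μ ν
      = ∫⁻ x, ⨆ F : CcMinorant (Function.uncurry κ), ENNReal.ofReal (∫ y, F.1 (x, y) ∂ν) ∂μ :=
        lintegral_congr fun x => pot_eq_iSup hker hν x
    _ = ⨆ F : CcMinorant (Function.uncurry κ),
          ∫⁻ x, ENNReal.ofReal (∫ y, F.1 (x, y) ∂ν) ∂μ :=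
        lintegral_iSup_of_directed_of_lowerSemicontinuous μ
          (fun F => (ENNReal.continuous_ofReal.comp
            (continuous_integral_section F.2.1 F.2.2.1 ν)).lowerSemicontinuous)
          (directed_ofReal_integral_section ν)
    _ ≤ energy κ ν μ := iSup_le fun F => by
        have hF := F.2.1
        have hFs : Continuous fun p : X × X => F.1 p.swap := hF.comp continuous_swap
        have hFsc : HasCompactSupport fun p : X × X => F.1 p.swap :=
          F.2.2.1.comp_homeomorph (Homeomorph.prodComm X X)
        rw [← ofReal_integral_of_cc μ (continuous_integral_section hF F.2.2.1 ν)
          (hasCompactSupport_integral_section F.2.2.1 ν)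
          (fun x => integral_nonneg fun y => F.2.2.2.1 (x, y)),
          integral_integral_swap_of_hasCompactSupport (f := fun x y => F.1 (x, y)) hF F.2.2.1]
        refine (ofReal_integral_of_cc ν (continuous_integral_section hFs hFsc μ)
          (hasCompactSupport_integral_section hFsc μ)
          (fun x => integral_nonneg fun y => F.2.2.2.1 (y, x))).trans_le ?_
        refine lintegral_mono fun y => ?_
        have h1 := ofReal_integral_of_cc μ (f := fun x => F.1 (x, y)) (by fun_prop)
          (hasCompactSupport_section hFsc y) fun x => F.2.2.2.1 (x, y)
        simp only [Prod.swap_prod_mk]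
        rw [h1]
        refine lintegral_mono fun x => ?_
        rw [hker.symm y x]
        exact F.2.2.2.2 (x, y)

theorem energy_comm (hker : IsKernel κ) {μ ν : Measure X} (hμ : IsRadon μ)
    (hν : IsRadon ν) : energy κ μ ν = energy κ ν μ :=
  le_antisymm (energy_le_energy_swap hker hμ hν) (energy_le_energy_swap hker hν hμ)

end Potential


section Vague

/-- A regular measure has an inner regular companion with the same values on compact sets. -/
theorem exists_isRadon_integral_eq_of_regular (ρ : Measure X) [ρ.Regular] :
    ∃ m : Measure X, IsRadon m ∧
      ∀ f : X → ℝ, HasCompactSupport f → ∫ x, f x ∂m = ∫ x, f x ∂ρ := by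
  let φ : Set X → ℝ≥0∞ := fun s => ⨆ K : TopologicalSpace.Compacts X, ρ (s ∩ K)
  let m : Measure X := Measure.ofMeasurable (fun s _ => φ s) (by simp [φ]) fun s hs hd => by
    have h1 : ∀ K : TopologicalSpace.Compacts X, ρ ((⋃ i, s i) ∩ K) = ∑' i, ρ (s i ∩ K) := by
      intro K
      rw [iUnion_inter]
      exact measure_iUnion (fun i j hij => (hd hij).mono inter_subset_left inter_subset_left)
        fun i => (hs i).inter K.isCompact.measurableSet
    simp only [φ, h1]
    refine le_antisymm (iSup_le fun K => ENNReal.tsum_le_tsum fun i =>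
      le_iSup (fun K : TopologicalSpace.Compacts X => ρ (s i ∩ K)) K) ?_
    rw [ENNReal.tsum_eq_iSup_sum]
    refine iSup_le fun t => ?_
    rw [ENNReal.finsetSum_iSup (f := fun i (K : TopologicalSpace.Compacts X) => ρ (s i ∩ K))
      fun K L => ⟨K ⊔ L, fun i => ⟨?_, ?_⟩⟩]
    · exact iSup_mono fun K => ENNReal.sum_le_tsum t
    · exact measure_mono (inter_subset_inter_right _ (by simp))
    · exact measure_mono (inter_subset_inter_right _ (by simp))
  have m_apply : ∀ s, MeasurableSet s → m s = φ s := fun s hs => Measure.ofMeasurable_apply s hs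
  have m_restrict : ∀ K : Set X, IsCompact K → m.restrict K = ρ.restrict K := by
    intro K hK
    ext s hs
    rw [Measure.restrict_apply hs, Measure.restrict_apply hs,
      m_apply _ (hs.inter hK.measurableSet)]
    refine le_antisymm (iSup_le fun L => measure_mono inter_subset_left) ?_
    refine le_iSup_of_le (⟨K, hK⟩ : TopologicalSpace.Compacts X) (measure_mono ?_)
    exact fun x hx => ⟨hx, hx.2⟩
  have m_compact : ∀ K : Set X, IsCompact K → m K = ρ K := fun K hK => by
    simpa using congrArg (fun ν : Measure X => ν univ) (m_restrict K hK)
  refine ⟨m, ⟨⟨fun s hs r hr => ?_⟩, ⟨fun x => ?_⟩⟩, fun f hf => ?_⟩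
  · rw [m_apply s hs] at hr
    obtain ⟨K, hK⟩ := lt_iSup_iff.1 hr
    obtain ⟨L, hL, hLc, hrL⟩ := (hs.inter K.isCompact.measurableSet).exists_lt_isCompact_of_ne_top
      (measure_ne_top_of_subset inter_subset_right K.isCompact.measure_ne_top) hK
    exact ⟨L, hL.trans inter_subset_left, hLc, by rwa [m_compact L hLc]⟩
  · obtain ⟨K, hK, hxK⟩ := exists_compact_mem_nhds x
    exact ⟨K, hxK, by rw [m_compact K hK]; exact hK.measure_lt_top⟩
  · have h0 : ∀ x, x ∉ tsupport f → f x = 0 := fun x hx => image_eq_zero_of_notMem_tsupport hx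
    rw [← setIntegral_eq_integral_of_forall_compl_eq_zero h0,
      ← setIntegral_eq_integral_of_forall_compl_eq_zero (μ := ρ) h0, m_restrict _ hf]

open CompactlySupported in
/-- Families of Radon measures that are bounded on compact sets have vague limits along
ultrafilters. -/
theorem exists_vagueConv_of_bounded {ι : Type*} (G : Ultrafilter ι) (m : ι → Measure X)
    (hm : ∀ i, IsRadon (m i))
    (hb : ∀ K : Set X, IsCompact K → ∃ C : ℝ≥0, ∀ i, m i K ≤ C) :
    ∃ ν : Measure X, IsRadon ν ∧ VagueConv (G : Filter ι) m ν := by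
  have := fun i => (hm i).isFiniteMeasureOnCompacts
  have hlim : ∀ f : C_c(X, ℝ), ∃ L : ℝ, Tendsto (fun i => ∫ x, f x ∂(m i)) G (𝓝 L) := by
    intro f
    obtain ⟨C, hC⟩ := hb _ f.hasCompactSupport
    obtain ⟨R, hR⟩ := f.hasCompactSupport.exists_bound_of_continuous f.continuous
    have hR0 : 0 ≤ max R 0 := le_max_right _ _
    have hmem : ∀ i, ∫ x, f x ∂(m i) ∈ Icc (-(max R 0 * C)) (max R 0 * C) := fun i => by
      rw [mem_Icc, ← abs_le, ← Real.norm_eq_abs,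
        ← setIntegral_eq_integral_of_forall_compl_eq_zero
          (fun x hx => image_eq_zero_of_notMem_tsupport hx)]
      refine (norm_setIntegral_le_of_norm_le_const ((hC i).trans_lt ENNReal.coe_lt_top)
        fun x _ => (hR x).trans (le_max_left R 0)).trans ?_
      refine mul_le_mul_of_nonneg_left ?_ hR0
      exact ENNReal.toReal_le_coe_of_le_coe (hC i)
    obtain ⟨L, -, hL⟩ := isCompact_Icc.ultrafilter_le_nhds (G.map fun i => ∫ x, f x ∂(m i))
      (le_principal_iff.2 (Filter.mem_map.2 (Eventually.of_forall hmem)))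
    exact ⟨L, hL⟩
  choose Λ hΛ using hlim
  have hfint : ∀ (f : C_c(X, ℝ)) i, Integrable (fun x => f x) (m i) := fun f i =>
    f.continuous.integrable_of_hasCompactSupport f.hasCompactSupport
  let Λlin : C_c(X, ℝ) →ₗ[ℝ] ℝ :=
    { toFun := Λ
      map_add' := fun f g => tendsto_nhds_unique (hΛ (f + g)) (by
        simpa only [CompactlySupportedContinuousMap.coe_add, Pi.add_apply,
          integral_add (hfint f _) (hfint g _)] using (hΛ f).add (hΛ g))
      map_smul' := fun c f => tendsto_nhds_unique (hΛ (c • f)) (by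
        simpa only [CompactlySupportedContinuousMap.coe_smul, Pi.smul_apply, integral_smul,
          RingHom.id_apply] using (hΛ f).const_smul c) }
  let Λpos : C_c(X, ℝ) →ₚ[ℝ] ℝ := PositiveLinearMap.mk₀ Λlin fun f hf =>
    ge_of_tendsto' (hΛ f) fun i => integral_nonneg fun x => hf x
  obtain ⟨ν, hν, hνρ⟩ := exists_isRadon_integral_eq_of_regular (RealRMK.rieszMeasure Λpos)
  refine ⟨ν, hν, fun f hf hfc => ?_⟩
  let F : C_c(X, ℝ) := ⟨⟨f, hf⟩, hfc⟩
  have : ∫ x, f x ∂ν = Λ F := by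
    rw [hνρ f hfc]
    exact RealRMK.integral_rieszMeasure Λpos F
  rw [this]
  exact hΛ F

theorem VagueConv.lintegral_le {ι : Type*} {G : Filter ι} [G.NeBot] {m : ι → Measure X}
    {ν : Measure X} (h : VagueConv G m ν) (hm : ∀ i, IsRadon (m i)) (hν : IsRadon ν)
    {f : X → ℝ≥0∞} (hf : LowerSemicontinuous f) {c : ℝ≥0∞}
    (hc : ∀ i, ∫⁻ x, f x ∂(m i) ≤ c) : ∫⁻ x, f x ∂ν ≤ c := by
  have := hν.1
  have := hν.isFiniteMeasureOnCompacts
  have := fun i => (hm i).isFiniteMeasureOnCompacts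
  rw [lintegral_eq_iSup_ccMinorant ν hf]
  refine iSup_le fun g => ?_
  rw [← ofReal_integral_of_cc ν g.2.1 g.2.2.1 g.2.2.2.1]
  refine le_of_tendsto' ((ENNReal.continuous_ofReal.tendsto _).comp (h g.1 g.2.1 g.2.2.1))
    fun i => ?_
  rw [Function.comp_apply, ofReal_integral_of_cc (m i) g.2.1 g.2.2.1 g.2.2.2.1]
  exact (lintegral_mono g.2.2.2.2).trans (hc i)

variable {κ : X → X → ℝ≥0∞}

theorem VagueConv.pot_le (hker : IsKernel κ) {ι : Type*} {G : Filter ι} [G.NeBot]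
    {m : ι → Measure X} {ν : Measure X} (h : VagueConv G m ν) (hm : ∀ i, IsRadon (m i))
    (hν : IsRadon ν) {x : X} {c : ℝ≥0∞} (hc : ∀ i, pot κ (m i) x ≤ c) : pot κ ν x ≤ c :=
  h.lintegral_le hm hν (hker.lsc_section x) hc

theorem energy_mutual_le (hE : EnergyPrinciple κ) {μ ν : Measure X} (hμ : μ ∈ Eplus κ)
    (hν : ν ∈ Eplus κ) {B : ℝ≥0∞} (hμB : energy κ μ μ ≤ B) (hνB : energy κ ν ν ≤ B) :
    energy κ μ ν ≤ B := by
  have h := ((hE μ hμ ν hν).1.trans (add_le_add hμB hνB)).trans_eq (two_mul B).symm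
  exact (ENNReal.mul_le_mul_iff_right two_ne_zero ENNReal.ofNat_ne_top).1 h

theorem energy_lt_top (hE : EnergyPrinciple κ) {μ ν : Measure X} (hμ : μ ∈ Eplus κ)
    (hν : ν ∈ Eplus κ) : energy κ μ ν < ⊤ :=
  (energy_mutual_le hE hμ hν (le_max_left _ _) (le_max_right _ _)).trans_lt
    (max_lt hμ.2 hν.2)

theorem VagueConv.energy_le (hker : IsKernel κ) (hE : EnergyPrinciple κ) {ι : Type*}
    {G : Filter ι} [G.NeBot] {m : ι → Measure X} {ν : Measure X} (h : VagueConv G m ν)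
    (hm : ∀ i, m i ∈ Eplus κ) (hν : IsRadon ν) {B : ℝ≥0∞} (hB : ∀ i, energy κ (m i) (m i) ≤ B) :
    energy κ ν ν ≤ B := by
  refine h.lintegral_le (fun i => (hm i).1) hν (pot_lowerSemicontinuous hker hν) fun j => ?_
  change energy κ (m j) ν ≤ B
  rw [energy_comm hker (hm j).1 hν]
  refine h.lintegral_le (fun i => (hm i).1) hν (pot_lowerSemicontinuous hker (hm j).1) fun i => ?_
  exact energy_mutual_le hE (hm i) (hm j) (hB i) (hB j)

theorem zero_mem_Eplus : (0 : Measure X) ∈ Eplus κ :=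
  ⟨⟨inferInstance, inferInstance⟩, by simp [energy]⟩

theorem diag_pos (hE : EnergyPrinciple κ) (x : X) : κ x x ≠ 0 := by
  intro h
  have he : energy κ (Measure.dirac x) (Measure.dirac x) = 0 := by
    simp [energy, pot, lintegral_dirac, h]
  have hd : Measure.dirac x ∈ Eplus κ := by
    refine ⟨⟨⟨fun U hU r hr => ?_⟩, inferInstance⟩, he.trans_lt ENNReal.zero_lt_top⟩
    by_cases hx : x ∈ U
    · refine ⟨{x}, by simpa using hx, isCompact_singleton, hr.trans_le ?_⟩
      simp [hx]
    · simp [Measure.dirac_apply, hx] at hr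
  have h0 := (hE _ hd 0 zero_mem_Eplus).2 (by rw [he]; simp [energy, pot])
  have := congrArg (fun μ : Measure X => μ univ) h0
  simp at this

/-- A set of measures of bounded energy is bounded on compact sets. -/
theorem exists_measure_le_of_energy_le (hker : IsKernel κ) (hE : EnergyPrinciple κ) {ι : Type*}
    {m : ι → Measure X} {B : ℝ≥0∞} (hBt : B ≠ ⊤) (hB : ∀ i, energy κ (m i) (m i) ≤ B)
    {K : Set X} (hK : IsCompact K) : ∃ C : ℝ≥0, ∀ i, m i K ≤ C := by
  refine hK.induction_on (p := fun K => ∃ C : ℝ≥0, ∀ i, m i K ≤ C) ⟨0, by simp⟩ ?_ ?_ ?_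
  · rintro s t hst ⟨C, hC⟩
    exact ⟨C, fun i => (measure_mono hst).trans (hC i)⟩
  · rintro s t ⟨C, hC⟩ ⟨D, hD⟩
    refine ⟨C + D, fun i => (measure_union_le s t).trans ?_⟩
    push_cast
    exact add_le_add (hC i) (hD i)
  · intro x _
    obtain ⟨c, hc0, hc⟩ := ENNReal.lt_iff_exists_nnreal_btwn.1 (pos_iff_ne_zero.2 (diag_pos hE x))
    have hc0' : (c : ℝ≥0∞) ≠ 0 := hc0.ne'
    have hopen : IsOpen {p : X × X | (c : ℝ≥0∞) < Function.uncurry κ p} :=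
      hker.lsc.isOpen_preimage c
    obtain ⟨U, V, hU, hxU, hV, hxV, hUV⟩ := mem_nhds_prod_iff'.1 (hopen.mem_nhds
      (show (x, x) ∈ {p : X × X | (c : ℝ≥0∞) < Function.uncurry κ p} from hc))
    have hBc : 1 + B / c ≠ ⊤ :=
      ENNReal.add_ne_top.2 ⟨ENNReal.one_ne_top, (ENNReal.div_lt_top hBt hc0').ne⟩
    refine ⟨U ∩ V, mem_nhdsWithin_of_mem_nhds ((hU.inter hV).mem_nhds ⟨hxU, hxV⟩),
      (1 + B / c).toNNReal, fun i => ?_⟩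
    rw [ENNReal.coe_toNNReal hBc]
    set W := U ∩ V
    have hW : MeasurableSet W := (hU.inter hV).measurableSet
    have h1 : c * m i W * m i W ≤ B := by
      refine le_trans ?_ (hB i)
      calc c * m i W * m i W = ∫⁻ x in W, c * m i W ∂(m i) := by simp
        _ ≤ ∫⁻ x in W, pot κ (m i) x ∂(m i) := by
            refine setLIntegral_mono' hW fun y hy => ?_
            calc c * m i W = ∫⁻ z in W, c ∂(m i) := by simp
              _ ≤ ∫⁻ z in W, κ y z ∂(m i) := setLIntegral_mono' hW fun z hz =>
                  le_of_lt (show (c : ℝ≥0∞) < κ y z from hUV (mk_mem_prod hy.1 hz.2))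
              _ ≤ _ := setLIntegral_le_lintegral _ _
        _ ≤ _ := setLIntegral_le_lintegral _ _
    rcases le_total (m i W) 1 with h2 | h2
    · exact h2.trans le_self_add
    · refine le_add_left ?_
      rw [ENNReal.le_div_iff_mul_le (Or.inl hc0') (Or.inl ENNReal.coe_ne_top)]
      calc m i W * c = c * m i W * 1 := by ring
        _ ≤ c * m i W * m i W := by gcongr
        _ ≤ B := h1

end Vague


section Bilinear

variable {κ : X → X → ℝ≥0∞}

/-- The mutual energy as a real number. -/
noncomputable def realEnergy (κ : X → X → ℝ≥0∞) (μ ν : Measure X) : ℝ :=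
  (energy κ μ ν).toReal

theorem IsRadon.add {μ ν : Measure X} (hμ : IsRadon μ) (hν : IsRadon ν) : IsRadon (μ + ν) := by
  have := hμ.1
  have := hμ.2
  have := hν.1
  have := hν.2
  refine ⟨inferInstance, ⟨fun x => ?_⟩⟩
  obtain ⟨U, hxU, hU⟩ := μ.finiteAt_nhds x
  obtain ⟨V, hxV, hV⟩ := ν.finiteAt_nhds x
  refine ⟨U ∩ V, inter_mem hxU hxV, ?_⟩
  rw [Measure.add_apply]
  exact ENNReal.add_lt_top.2 ⟨(measure_mono inter_subset_left).trans_lt hU,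
    (measure_mono inter_subset_right).trans_lt hV⟩

theorem IsRadon.smul {μ : Measure X} (hμ : IsRadon μ) (c : ℝ≥0) : IsRadon (c • μ) := by
  have := hμ.1
  have := hμ.2
  exact ⟨inferInstance, inferInstance⟩

theorem pot_add (μ ν : Measure X) (x : X) : pot κ (μ + ν) x = pot κ μ x + pot κ ν x :=
  lintegral_add_measure _ _ _

theorem pot_smul (c : ℝ≥0) (μ : Measure X) (x : X) : pot κ (c • μ) x = c * pot κ μ x :=
  lintegral_smul_measure c _

theorem energy_add_left (μ ν η : Measure X) :
    energy κ (μ + ν) η = energy κ μ η + energy κ ν η :=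
  lintegral_add_measure _ _ _

theorem energy_smul_left (c : ℝ≥0) (μ ν : Measure X) :
    energy κ (c • μ) ν = c * energy κ μ ν :=
  lintegral_smul_measure c _

theorem energy_add_right (hker : IsKernel κ) {μ ν η : Measure X} (hμ : IsRadon μ) :
    energy κ η (μ + ν) = energy κ η μ + energy κ η ν := by
  simp only [energy, pot_add]
  exact lintegral_add_left (pot_measurable hker hμ) _

theorem energy_smul_right (c : ℝ≥0) (μ ν : Measure X) :
    energy κ μ (c • ν) = c * energy κ μ ν := by
  simp only [energy, pot_smul]
  exact lintegral_const_mul' _ _ ENNReal.coe_ne_top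

theorem Eplus.add (hker : IsKernel κ) (hE : EnergyPrinciple κ) {μ ν : Measure X}
    (hμ : μ ∈ Eplus κ) (hν : ν ∈ Eplus κ) : μ + ν ∈ Eplus κ := by
  refine ⟨hμ.1.add hν.1, ?_⟩
  rw [energy_add_left, energy_add_right hker hμ.1, energy_add_right hker hμ.1]
  exact ENNReal.add_lt_top.2 ⟨ENNReal.add_lt_top.2 ⟨hμ.2, energy_lt_top hE hμ hν⟩,
    ENNReal.add_lt_top.2 ⟨energy_lt_top hE hν hμ, hν.2⟩⟩

theorem Eplus.smul {μ : Measure X} (hμ : μ ∈ Eplus κ) (c : ℝ≥0) : c • μ ∈ Eplus κ := by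
  refine ⟨hμ.1.smul c, ?_⟩
  rw [energy_smul_left, energy_smul_right]
  exact ENNReal.mul_lt_top ENNReal.coe_lt_top (ENNReal.mul_lt_top ENNReal.coe_lt_top hμ.2)

theorem realEnergy_nonneg (μ ν : Measure X) : 0 ≤ realEnergy κ μ ν := ENNReal.toReal_nonneg

theorem realEnergy_comm (hker : IsKernel κ) {μ ν : Measure X} (hμ : μ ∈ Eplus κ)
    (hν : ν ∈ Eplus κ) : realEnergy κ μ ν = realEnergy κ ν μ := by
  rw [realEnergy, energy_comm hker hμ.1 hν.1, realEnergy]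

theorem realEnergy_add_left (hE : EnergyPrinciple κ) {μ ν η : Measure X} (hμ : μ ∈ Eplus κ)
    (hν : ν ∈ Eplus κ) (hη : η ∈ Eplus κ) :
    realEnergy κ (μ + ν) η = realEnergy κ μ η + realEnergy κ ν η := by
  rw [realEnergy, energy_add_left, ENNReal.toReal_add (energy_lt_top hE hμ hη).ne
    (energy_lt_top hE hν hη).ne, realEnergy, realEnergy]

theorem realEnergy_add_right (hker : IsKernel κ) (hE : EnergyPrinciple κ) {μ ν η : Measure X}
    (hμ : μ ∈ Eplus κ) (hν : ν ∈ Eplus κ) (hη : η ∈ Eplus κ) :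
    realEnergy κ η (μ + ν) = realEnergy κ η μ + realEnergy κ η ν := by
  rw [realEnergy, energy_add_right hker hμ.1, ENNReal.toReal_add (energy_lt_top hE hη hμ).ne
    (energy_lt_top hE hη hν).ne, realEnergy, realEnergy]

theorem realEnergy_smul_left (c : ℝ≥0) (μ ν : Measure X) :
    realEnergy κ (c • μ) ν = c * realEnergy κ μ ν := by
  simp [realEnergy, energy_smul_left]

theorem realEnergy_smul_right (c : ℝ≥0) (μ ν : Measure X) :
    realEnergy κ μ (c • ν) = c * realEnergy κ μ ν := by
  simp [realEnergy, energy_smul_right]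

theorem two_mul_realEnergy_le (hE : EnergyPrinciple κ) {μ ν : Measure X} (hμ : μ ∈ Eplus κ)
    (hν : ν ∈ Eplus κ) :
    2 * realEnergy κ μ ν ≤ realEnergy κ μ μ + realEnergy κ ν ν := by
  have h := ENNReal.toReal_mono (ENNReal.add_ne_top.2 ⟨hμ.2.ne, hν.2.ne⟩) (hE μ hμ ν hν).1
  rwa [ENNReal.toReal_add hμ.2.ne hν.2.ne, ENNReal.toReal_mul] at h

theorem strDist_sq (hE : EnergyPrinciple κ) {μ ν : Measure X} (hμ : μ ∈ Eplus κ)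
    (hν : ν ∈ Eplus κ) :
    strDist κ μ ν ^ 2 = realEnergy κ μ μ - 2 * realEnergy κ μ ν + realEnergy κ ν ν :=
  Real.sq_sqrt (by have := two_mul_realEnergy_le hE hμ hν; unfold realEnergy at this; linarith)

theorem realEnergy_add_smul_self (hker : IsKernel κ) (hE : EnergyPrinciple κ) {μ ν : Measure X}
    (hμ : μ ∈ Eplus κ) (hν : ν ∈ Eplus κ) (t : ℝ≥0) :
    realEnergy κ (μ + t • ν) (μ + t • ν) =
      realEnergy κ μ μ + 2 * t * realEnergy κ μ ν + t ^ 2 * realEnergy κ ν ν := by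
  have ht := Eplus.smul hν t
  rw [realEnergy_add_left hE hμ ht (Eplus.add hker hE hμ ht),
    realEnergy_add_right hker hE hμ ht hμ, realEnergy_add_right hker hE hμ ht ht,
    realEnergy_smul_right, realEnergy_smul_right, realEnergy_smul_left, realEnergy_smul_left,
    realEnergy_comm hker hν hμ]
  ring

/-- A weak form of the Cauchy–Schwarz inequality for `(μ - ν, η)`. -/
theorem abs_realEnergy_sub_le (hker : IsKernel κ) (hE : EnergyPrinciple κ) {μ ν η : Measure X}
    (hμ : μ ∈ Eplus κ) (hν : ν ∈ Eplus κ) (hη : η ∈ Eplus κ) (t : ℝ≥0) :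
    2 * t * |realEnergy κ μ η - realEnergy κ ν η| ≤
      strDist κ μ ν ^ 2 + t ^ 2 * realEnergy κ η η := by
  have key : ∀ {μ ν : Measure X}, μ ∈ Eplus κ → ν ∈ Eplus κ →
      2 * t * (realEnergy κ ν η - realEnergy κ μ η) ≤
        strDist κ μ ν ^ 2 + t ^ 2 * realEnergy κ η η := fun {μ ν} hμ hν => by
    have h := two_mul_realEnergy_le hE (Eplus.add hker hE hμ (Eplus.smul hη t)) hν
    rw [realEnergy_add_smul_self hker hE hμ hη, realEnergy_add_left hE hμ (Eplus.smul hη t) hν,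
      realEnergy_smul_left, realEnergy_comm hker hη hν] at h
    rw [strDist_sq hE hμ hν]
    linarith
  have h1 := key hμ hν
  have h2 := key hν hμ
  have h3 : strDist κ ν μ ^ 2 = strDist κ μ ν ^ 2 := by
    rw [strDist_sq hE hμ hν, strDist_sq hE hν hμ, realEnergy_comm hker hν hμ]; ring
  rcases abs_cases (realEnergy κ μ η - realEnergy κ ν η) with ⟨h, -⟩ | ⟨h, -⟩ <;> rw [h] <;>
    linarith

theorem tendsto_realEnergy_left (hker : IsKernel κ) (hE : EnergyPrinciple κ) {m : ℕ → Measure X}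
    {b η : Measure X} (hm : ∀ n, m n ∈ Eplus κ) (hb : b ∈ Eplus κ) (hη : η ∈ Eplus κ)
    (h : Tendsto (fun n => strDist κ (m n) b) atTop (𝓝 0)) :
    Tendsto (fun n => realEnergy κ (m n) η) atTop (𝓝 (realEnergy κ b η)) := by
  have hs0 : ∀ n, 0 ≤ strDist κ (m n) b := fun n => Real.sqrt_nonneg _
  have h1 : Tendsto (fun n : ℕ => 1 / ((n : ℝ) + 1)) atTop (𝓝 0) :=
    tendsto_one_div_add_atTop_nhds_zero_nat
  rw [tendsto_iff_dist_tendsto_zero]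
  have hlim : Tendsto (fun n : ℕ => strDist κ (m n) b +
      (strDist κ (m n) b + 1 / ((n : ℝ) + 1)) * realEnergy κ η η) atTop (𝓝 0) := by
    simpa using h.add ((h.add h1).mul_const (realEnergy κ η η))
  refine squeeze_zero (fun n => dist_nonneg) (fun n => ?_) hlim
  have hn : 0 < 1 / ((n : ℝ) + 1) := by positivity
  set s := strDist κ (m n) b
  set t := s + 1 / ((n : ℝ) + 1)
  have ht : 0 < t := add_pos_of_nonneg_of_pos (hs0 n) hn
  have hst : s ≤ t := le_add_of_nonneg_right hn.le
  have key := abs_realEnergy_sub_le hker hE (hm n) hb hη ⟨t, ht.le⟩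
  rw [Real.dist_eq]
  have he := realEnergy_nonneg (κ := κ) η η
  have habs := abs_nonneg (realEnergy κ (m n) η - realEnergy κ b η)
  have h2 : s ^ 2 ≤ t * s := by nlinarith [hs0 n]
  have h3 : t * (2 * |realEnergy κ (m n) η - realEnergy κ b η|) ≤
      t * (s + t * realEnergy κ η η) := by
    change 2 * t * |realEnergy κ (m n) η - realEnergy κ b η| ≤ s ^ 2 + t ^ 2 * _ at key
    nlinarith
  have h4 := le_of_mul_le_mul_left h3 ht
  linarith

theorem tendsto_realEnergy_self (hker : IsKernel κ) (hE : EnergyPrinciple κ) {m : ℕ → Measure X}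
    {b : Measure X} (hm : ∀ n, m n ∈ Eplus κ) (hb : b ∈ Eplus κ)
    (h : Tendsto (fun n => strDist κ (m n) b) atTop (𝓝 0)) :
    Tendsto (fun n => realEnergy κ (m n) (m n)) atTop (𝓝 (realEnergy κ b b)) := by
  have h1 := tendsto_realEnergy_left hker hE hm hb hb h
  have h2 := ((h.pow 2).add (h1.const_mul 2)).sub_const (realEnergy κ b b)
  refine (h2.congr fun n => ?_).trans_eq ?_
  · rw [strDist_sq hE (hm n) hb]; ring
  · congr 1; ring

end Bilinear

section Projection

variable {κ : X → X → ℝ≥0∞}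

/-- A convex cone of measures of finite energy. -/
structure IsEnergyCone (κ : X → X → ℝ≥0∞) (C : Set (Measure X)) : Prop where
  subset : C ⊆ Eplus κ
  zero_mem : (0 : Measure X) ∈ C
  add_mem : ∀ μ ∈ C, ∀ ν ∈ C, μ + ν ∈ C
  smul_mem : ∀ (c : ℝ≥0), ∀ μ ∈ C, c • μ ∈ C

/-- The Gauss functional `κ(ν,ν) - 2κ(μ,ν)`. -/
noncomputable def gauss (κ : X → X → ℝ≥0∞) (μ ν : Measure X) : ℝ :=
  realEnergy κ ν ν - 2 * realEnergy κ μ ν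

theorem neg_energy_le_gauss (hE : EnergyPrinciple κ) {μ ν : Measure X} (hμ : μ ∈ Eplus κ)
    (hν : ν ∈ Eplus κ) : -realEnergy κ μ μ ≤ gauss κ μ ν := by
  have := two_mul_realEnergy_le hE hμ hν
  unfold gauss
  linarith

theorem exists_gauss_minimizing_seq (hE : EnergyPrinciple κ) {C : Set (Measure X)}
    (hC : IsEnergyCone κ C) {μ : Measure X} (hμ : μ ∈ Eplus κ) :
    ∃ m : ℕ → Measure X, ∀ n, m n ∈ C ∧
      ∀ ν ∈ C, gauss κ μ (m n) ≤ gauss κ μ ν + 1 / ((n : ℝ) + 1) := by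
  have hbdd : BddBelow (gauss κ μ '' C) := by
    refine ⟨-realEnergy κ μ μ, ?_⟩
    rintro _ ⟨ν, hν, rfl⟩
    exact neg_energy_le_gauss hE hμ (hC.subset hν)
  have : ∀ n : ℕ, ∃ m, m ∈ C ∧ ∀ ν ∈ C, gauss κ μ m ≤ gauss κ μ ν + 1 / ((n : ℝ) + 1) := by
    intro n
    have hn : 0 < 1 / ((n : ℝ) + 1) := by positivity
    obtain ⟨_, ⟨m, hm, rfl⟩, hlt⟩ :=
      exists_lt_of_csInf_lt ⟨_, mem_image_of_mem (gauss κ μ) hC.zero_mem⟩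
        (lt_add_of_pos_right (sInf (gauss κ μ '' C)) hn)
    refine ⟨m, hm, fun ν hν => ?_⟩
    have := csInf_le hbdd (mem_image_of_mem (gauss κ μ) hν)
    linarith
  choose m hm using this
  exact ⟨m, hm⟩

/-- The parallelogram law for the Gauss functional. -/
theorem strDist_sq_eq_gauss (hker : IsKernel κ) (hE : EnergyPrinciple κ) {μ ν η : Measure X}
    (hμ : μ ∈ Eplus κ) (hν : ν ∈ Eplus κ) (hη : η ∈ Eplus κ) :
    strDist κ ν η ^ 2 = 2 * gauss κ μ ν + 2 * gauss κ μ η -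
      4 * gauss κ μ ((2⁻¹ : ℝ≥0) • (ν + (1 : ℝ≥0) • η)) := by
  have h1 := Eplus.smul hη 1
  rw [strDist_sq hE hν hη]
  simp only [gauss, realEnergy_smul_left, realEnergy_smul_right,
    realEnergy_add_smul_self hker hE hν hη, realEnergy_add_right hker hE hν h1 hμ]
  push_cast
  ring

/-- Minimizing sequences of the Gauss functional over a convex cone have vague limits, and these
satisfy the variational inequalities of a projection. -/
theorem exists_vague_limit_of_minimizing (hker : IsKernel κ) (hE : EnergyPrinciple κ)
    (hcons : Consistent κ) {C : Set (Measure X)} (hC : IsEnergyCone κ C) {μ : Measure X}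
    (hμ : μ ∈ Eplus κ) {m : ℕ → Measure X} (hmC : ∀ n, m n ∈ C)
    (hmin : ∀ n, ∀ ν ∈ C, gauss κ μ (m n) ≤ gauss κ μ ν + 1 / ((n : ℝ) + 1)) :
    ∃ b ∈ Eplus κ, VagueConv (hyperfilter ℕ : Filter ℕ) m b ∧
      (∀ ν ∈ C, energy κ μ ν ≤ energy κ b ν) ∧ energy κ μ b = energy κ b b := by
  have hm : ∀ n, m n ∈ Eplus κ := fun n => hC.subset (hmC n)
  have h1 : Tendsto (fun n : ℕ => 1 / ((n : ℝ) + 1)) atTop (𝓝 0) :=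
    tendsto_one_div_add_atTop_nhds_zero_nat
  have hbd : ∀ n, energy κ (m n) (m n) ≤ ENNReal.ofReal (2 + 4 * realEnergy κ μ μ) := by
    intro n
    rw [ENNReal.le_ofReal_iff_toReal_le (hm n).2.ne
      (by have := realEnergy_nonneg (κ := κ) μ μ; positivity)]
    change realEnergy κ (m n) (m n) ≤ _
    have h2 := hmin n 0 hC.zero_mem
    have h3 : 1 / ((n : ℝ) + 1) ≤ 1 := by
      rw [div_le_one (by positivity)]
      linarith [n.cast_nonneg (α := ℝ)]
    have h4 := two_mul_realEnergy_le hE (Eplus.smul hμ 2) (hm n)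
    simp only [realEnergy_smul_left, realEnergy_smul_right] at h4
    have h5 : gauss κ μ 0 = 0 := by simp [gauss, realEnergy, energy, pot]
    rw [h5] at h2
    unfold gauss at h2
    push_cast at h4
    linarith
  obtain ⟨b, hbR, hb⟩ := exists_vagueConv_of_bounded (hyperfilter ℕ) m (fun n => (hm n).1)
    fun K hK => exists_measure_le_of_energy_le hker hE ENNReal.ofReal_ne_top hbd hK
  have hbE : b ∈ Eplus κ :=
    ⟨hbR, (hb.energy_le hker hE hm hbR hbd).trans_lt ENNReal.ofReal_lt_top⟩
  have hcauchy : StrongCauchy κ atTop m := by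
    intro ε hε
    obtain ⟨N, hN⟩ := ((tendsto_order.1 h1).2 (ε ^ 2 / 4) (by positivity)).exists_forall_of_atTop
    refine ⟨Ici N, Ici_mem_atTop N, fun i hi j hj => ?_⟩
    have hmid : (2⁻¹ : ℝ≥0) • (m i + (1 : ℝ≥0) • m j) ∈ C :=
      hC.smul_mem _ _ (hC.add_mem _ (hmC i) _ (hC.smul_mem _ _ (hmC j)))
    have h2 := strDist_sq_eq_gauss hker hE hμ (hm i) (hm j)
    have h3 := hmin i _ hmid
    have h4 := hmin j _ hmid
    have h5 := hN i hi
    have h6 := hN j hj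
    refine lt_of_pow_lt_pow_left₀ 2 hε.le ?_
    linarith
  have hstrong := hcons ℕ atTop m inferInstance hm hcauchy b
    ⟨(hyperfilter ℕ : Filter ℕ), Nat.hyperfilter_le_atTop, inferInstance, hb⟩
  have hleft : ∀ ν ∈ Eplus κ,
      Tendsto (fun n => realEnergy κ (m n) ν) atTop (𝓝 (realEnergy κ b ν)) :=
    fun ν hν => tendsto_realEnergy_left hker hE hm hbE hν hstrong
  have hright : Tendsto (fun n => realEnergy κ μ (m n)) atTop (𝓝 (realEnergy κ μ b)) := by
    rw [realEnergy_comm hker hμ hbE]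
    exact (hleft μ hμ).congr fun n => realEnergy_comm hker (hm n) hμ
  have hself := tendsto_realEnergy_self hker hE hm hbE hstrong
  have hvar : ∀ ν ∈ C, realEnergy κ μ ν ≤ realEnergy κ b ν := by
    intro ν hν
    have hνE := hC.subset hν
    have key : ∀ t : ℝ≥0, 0 < t →
        0 ≤ 2 * (realEnergy κ b ν - realEnergy κ μ ν) + t * realEnergy κ ν ν := by
      intro t ht
      have ht' : (0 : ℝ) < t := ht
      have hlim : Tendsto (fun n : ℕ => 2 * t * (realEnergy κ (m n) ν - realEnergy κ μ ν) +
          t ^ 2 * realEnergy κ ν ν + 1 / ((n : ℝ) + 1)) atTop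
          (𝓝 (2 * t * (realEnergy κ b ν - realEnergy κ μ ν) +
          t ^ 2 * realEnergy κ ν ν + 0)) :=
        ((((hleft ν hνE).sub_const _).const_mul _).add_const _).add h1
      have h2 := ge_of_tendsto' hlim (b := 0) fun n => by
        have h3 := hmin n _ (hC.add_mem _ (hmC n) _ (hC.smul_mem t _ hν))
        simp only [gauss, realEnergy_add_smul_self hker hE (hm n) hνE,
          realEnergy_add_right hker hE (hm n) (Eplus.smul hνE t) hμ, realEnergy_smul_right] at h3
        linarith
      refine nonneg_of_mul_nonneg_right (a := (t : ℝ)) ?_ ht'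
      linarith
    have hlim : Tendsto (fun n : ℕ => 2 * (realEnergy κ b ν - realEnergy κ μ ν) +
        1 / ((n : ℝ) + 1) * realEnergy κ ν ν) atTop
        (𝓝 (2 * (realEnergy κ b ν - realEnergy κ μ ν) + 0 * realEnergy κ ν ν)) :=
      (h1.mul_const _).const_add _
    have h2 := ge_of_tendsto' hlim (b := 0) fun n => by
      have := key (1 / ((n : ℝ≥0) + 1)) (by positivity)
      simpa using this
    linarith
  have hge : realEnergy κ μ b ≤ realEnergy κ b b := by
    have hbb : Tendsto (fun n => realEnergy κ b (m n)) atTop (𝓝 (realEnergy κ b b)) :=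
      (hleft b hbE).congr fun n => realEnergy_comm hker (hm n) hbE
    exact le_of_tendsto_of_tendsto' hright hbb fun n => hvar _ (hmC n)
  have hle : realEnergy κ b b ≤ realEnergy κ μ b := by
    have key : ∀ t : ℝ≥0, 0 < t → t ≤ 1 →
        0 ≤ 2 * (realEnergy κ μ b - realEnergy κ b b) + t * realEnergy κ b b := by
      intro t ht ht1
      have ht' : (0 : ℝ) < t := ht
      have hlim : Tendsto (fun n : ℕ => (t ^ 2 - 2 * t) * realEnergy κ (m n) (m n) +
          2 * t * realEnergy κ μ (m n) + 1 / ((n : ℝ) + 1)) atTop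
          (𝓝 ((t ^ 2 - 2 * t) * realEnergy κ b b + 2 * t * realEnergy κ μ b + 0)) :=
        ((hself.const_mul _).add (hright.const_mul _)).add h1
      have h2 := ge_of_tendsto' hlim (b := 0) fun n => by
        have h3 := hmin n _ (hC.smul_mem (1 - t) _ (hmC n))
        simp only [gauss, realEnergy_smul_left, realEnergy_smul_right, NNReal.coe_sub ht1,
          NNReal.coe_one] at h3
        linarith
      refine nonneg_of_mul_nonneg_right (a := (t : ℝ)) ?_ ht'
      linarith
    have hlim : Tendsto (fun n : ℕ => 2 * (realEnergy κ μ b - realEnergy κ b b) +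
        1 / ((n : ℝ) + 1) * realEnergy κ b b) atTop
        (𝓝 (2 * (realEnergy κ μ b - realEnergy κ b b) + 0 * realEnergy κ b b)) :=
      (h1.mul_const _).const_add _
    have h2 := ge_of_tendsto' hlim (b := 0) fun n => by
      have := key (1 / ((n : ℝ≥0) + 1)) (by positivity)
        (div_le_one_of_le₀ (by simp) (by positivity))
      simpa using this
    linarith
  refine ⟨b, hbE, hb, fun ν hν => ?_, ?_⟩
  · exact (ENNReal.toReal_le_toReal (energy_lt_top hE hμ (hC.subset hν)).ne
      (energy_lt_top hE hbE (hC.subset hν)).ne).1 (hvar ν hν)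
  · exact (ENNReal.toReal_eq_toReal_iff' (energy_lt_top hE hμ hbE).ne hbE.2.ne).1
      (le_antisymm hge hle)

end Projection

section Restriction

variable {κ : X → X → ℝ≥0∞}

theorem IsRadon.restrict {μ : Measure X} (hμ : IsRadon μ) {S : Set X} (hS : MeasurableSet S) :
    IsRadon (μ.restrict S) := by
  have := hμ.1
  have := hμ.2
  refine ⟨⟨fun s hs r hr => ?_⟩, inferInstance⟩
  rw [Measure.restrict_apply hs] at hr
  obtain ⟨K, hK, hKc, hrK⟩ := (hs.inter hS).exists_lt_isCompact hr
  refine ⟨K, hK.trans inter_subset_left, hKc, ?_⟩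
  rwa [Measure.restrict_eq_self _ (hK.trans inter_subset_right)]

theorem pot_restrict_le (μ : Measure X) (S : Set X) (x : X) :
    pot κ (μ.restrict S) x ≤ pot κ μ x :=
  lintegral_mono' Measure.restrict_le_self le_rfl

theorem Eplus.restrict {μ : Measure X} (hμ : μ ∈ Eplus κ) {S : Set X} (hS : MeasurableSet S) :
    μ.restrict S ∈ Eplus κ :=
  ⟨hμ.1.restrict hS,
    (lintegral_mono' Measure.restrict_le_self fun x => pot_restrict_le μ S x).trans_lt hμ.2⟩

/-- A set on which `κβ < κμ` is `ν`-null if `κ(μ,·) ≤ κ(β,·)` at the restriction of `ν`. -/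
theorem measure_eq_zero_of_pot_lt (hker : IsKernel κ) (hE : EnergyPrinciple κ)
    {μ β ν : Measure X} (hμ : μ ∈ Eplus κ) (hβ : β ∈ Eplus κ) (hν : ν ∈ Eplus κ) {S : Set X}
    (hS : MeasurableSet S) (hlt : ∀ x ∈ S, pot κ β x < pot κ μ x)
    (hle : energy κ μ (ν.restrict S) ≤ energy κ β (ν.restrict S)) : ν S = 0 := by
  have hνS := Eplus.restrict hν hS
  rw [energy_comm hker hμ.1 hνS.1, energy_comm hker hβ.1 hνS.1] at hle
  have hae : pot κ β ≤ᵐ[ν.restrict S] pot κ μ :=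
    (ae_restrict_iff' hS).2 (ae_of_all _ fun x hx => (hlt x hx).le)
  have heq := ae_eq_of_ae_le_of_lintegral_le hae (energy_lt_top hE hνS hβ).ne
    (pot_measurable hker hμ.1).aemeasurable hle
  have : ∀ᵐ x ∂ν.restrict S, x ∉ S := by
    filter_upwards [heq] with x hx hxS
    exact (hlt x hxS).ne hx
  have h0 := (ae_iff.1 this)
  simpa [Measure.restrict_apply hS] using h0

end Restriction

section Capacity

variable {κ : X → X → ℝ≥0∞}

theorem ConcOn.of_compl_null {ν : Measure X} {A S : Set X} (hS : MeasurableSet S) (hSA : S ⊆ A)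
    (h : ν Sᶜ = 0) : ConcOn ν A := by
  refine ⟨?_, fun K _ => measure_mono_null
    (inter_subset_left.trans (compl_subset_compl.2 hSA)) h⟩
  have hnull : ν (A \ S) = 0 := measure_mono_null (fun x hx => hx.2) h
  rw [← union_sdiff_cancel hSA]
  exact hS.nullMeasurableSet.union (NullMeasurableSet.of_null hnull)

theorem measure_eq_zero_of_innerCap_eq_zero {N S : Set X} (hN : innerCap κ N = 0)
    (hS : MeasurableSet S) (hSN : S ⊆ N) {ν : Measure X} (hν : ν ∈ Eplus κ) : ν S = 0 := by
  have := hν.1.1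
  have := hν.1.isFiniteMeasureOnCompacts
  by_contra hne
  obtain ⟨K, hKS, hK, hpos⟩ := hS.exists_lt_isCompact (pos_iff_ne_zero.2 hne)
  have hfin : ν K < ∞ := hK.measure_lt_top
  set c : ℝ≥0 := (ν K).toNNReal with hc
  have hcK : (c : ℝ≥0∞) = ν K := ENNReal.coe_toNNReal hfin.ne
  have hc0 : c ≠ 0 := fun h => hpos.ne' (by rw [← hcK, h, ENNReal.coe_zero])
  have hmem : c⁻¹ • ν.restrict K ∈ Eplus κ :=
    Eplus.smul (Eplus.restrict hν hK.measurableSet) _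
  have hconc : ConcOn (c⁻¹ • ν.restrict K) N := by
    refine ConcOn.of_compl_null hK.measurableSet (hKS.trans hSN) ?_
    simp [Measure.restrict_apply hK.measurableSet.compl]
  have hone : (c⁻¹ • ν.restrict K) univ = 1 := by
    rw [Measure.smul_apply, Measure.restrict_apply_univ, ← hcK, ENNReal.smul_def, smul_eq_mul,
      ← ENNReal.coe_mul, inv_mul_cancel₀ hc0, ENNReal.coe_one]
  rw [innerCap, ENNReal.inv_eq_zero] at hN
  have hle : (⊤ : ℝ≥0∞) ≤ _ := hN.ge.trans (iInf₂_le (c⁻¹ • ν.restrict K) ⟨⟨hmem, hconc⟩, hone⟩)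
  exact hmem.2.not_ge hle

theorem exists_compact_of_innerCap_ne_zero {N : Set X} (hN : innerCap κ N ≠ 0) :
    ∃ ν ∈ Eplus κ, ∃ K, IsCompact K ∧ K ⊆ N ∧ ν K ≠ 0 := by
  have : ∃ ν ∈ EplusOn κ N, ν univ = 1 := by
    by_contra! h
    refine hN ?_
    rw [innerCap, ENNReal.inv_eq_zero]
    exact iInf₂_eq_top.2 fun ν hν => absurd hν.2 (h ν hν.1)
  obtain ⟨ν, ⟨hν, hmeas, hconc⟩, hone⟩ := this
  have := hν.1.1
  obtain ⟨T, hTN, hT, hTae⟩ := hmeas.exists_measurable_subset_ae_eq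
  have hTc : ν Tᶜ = 0 := by
    by_contra hne
    obtain ⟨K, hKT, hK, hpos⟩ := hT.compl.exists_lt_isCompact (pos_iff_ne_zero.2 hne)
    refine hpos.ne' (measure_mono_null (t := (Nᶜ ∩ K) ∪ (N \ T)) (fun x hx => ?_)
      (measure_union_null (hconc K hK) (ae_le_set.1 hTae.symm.le)))
    by_cases hxN : x ∈ N
    · exact Or.inr ⟨hxN, hKT hx⟩
    · exact Or.inl ⟨hxN, hx⟩
  have hTpos : ν T ≠ 0 := fun h => by
    have := measure_union_null h hTc
    rw [union_compl_self, hone] at this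
    exact one_ne_zero this
  obtain ⟨K, hKT, hK, hpos⟩ := hT.exists_lt_isCompact (pos_iff_ne_zero.2 hTpos)
  exact ⟨ν, hν, K, hK, hKT.trans hTN, hpos.ne'⟩

end Capacity

section Existence

variable {κ : X → X → ℝ≥0∞}

theorem isEnergyCone_compact (hker : IsKernel κ) (hE : EnergyPrinciple κ) (K : Set X) :
    IsEnergyCone κ {ν ∈ Eplus κ | ν Kᶜ = 0} where
  subset := fun _ h => h.1
  zero_mem := ⟨zero_mem_Eplus, rfl⟩
  add_mem := fun μ hμ ν hν => ⟨Eplus.add hker hE hμ.1 hν.1, by simp [hμ.2, hν.2]⟩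
  smul_mem := fun c μ hμ => ⟨Eplus.smul hμ.1 c, by simp [hμ.2]⟩

theorem isEnergyCone_compactly_carried (hker : IsKernel κ) (hE : EnergyPrinciple κ) (A : Set X) :
    IsEnergyCone κ {ν ∈ Eplus κ | ∃ K, IsCompact K ∧ K ⊆ A ∧ ν Kᶜ = 0} where
  subset := fun _ h => h.1
  zero_mem := ⟨zero_mem_Eplus, ∅, isCompact_empty, empty_subset _, rfl⟩
  add_mem := by
    rintro μ ⟨hμ, K, hK, hKA, hμK⟩ ν ⟨hν, L, hL, hLA, hνL⟩
    refine ⟨Eplus.add hker hE hμ hν, K ∪ L, hK.union hL, union_subset hKA hLA, ?_⟩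
    rw [Measure.add_apply, measure_mono_null (compl_subset_compl.2 subset_union_left) hμK,
      measure_mono_null (compl_subset_compl.2 subset_union_right) hνL, add_zero]
  smul_mem := by
    rintro c μ ⟨hμ, K, hK, hKA, hμK⟩
    exact ⟨Eplus.smul hμ c, K, hK, hKA, by simp [hμK]⟩

theorem restrict_compact_compl (ν : Measure X) {K L : Set X} (hK : MeasurableSet K)
    (hKL : K ⊆ L) : ν.restrict K Lᶜ = 0 :=
  measure_mono_null (compl_subset_compl.2 hKL) (by rw [Measure.restrict_apply hK.compl]; simp)

theorem gauss_le_of_variational (hE : EnergyPrinciple κ) {μ b ν : Measure X} (hb : b ∈ Eplus κ)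
    (hν : ν ∈ Eplus κ) (heq : energy κ μ b = energy κ b b)
    (hle : energy κ μ ν ≤ energy κ b ν) : gauss κ μ b ≤ gauss κ μ ν := by
  have h1 : realEnergy κ μ ν ≤ realEnergy κ b ν :=
    ENNReal.toReal_mono (energy_lt_top hE hb hν).ne hle
  have h2 : realEnergy κ μ b = realEnergy κ b b := congrArg ENNReal.toReal heq
  have h3 := two_mul_realEnergy_le hE hb hν
  unfold gauss
  linarith

/-- The inner balayage onto a compact set. -/
theorem exists_compact_projection (hker : IsKernel κ) (hE : EnergyPrinciple κ)
    (hcons : Consistent κ) (hD : Domination κ) {μ : Measure X} (hμ : μ ∈ Eplus κ) {K : Set X}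
    (hK : IsCompact K) :
    ∃ b ∈ Eplus κ, b Kᶜ = 0 ∧
      (∀ ν ∈ Eplus κ, ν Kᶜ = 0 → gauss κ μ b ≤ gauss κ μ ν) ∧ (∀ x, pot κ b x ≤ pot κ μ x) ∧
      ∀ A, K ⊆ A → ∀ ν ∈ InnerLam κ A μ, ∀ x, pot κ b x ≤ pot κ ν x := by
  obtain ⟨m, hm⟩ := exists_gauss_minimizing_seq hE (isEnergyCone_compact hker hE K) hμ
  obtain ⟨b, hb, hconv, hvar, heq⟩ := exists_vague_limit_of_minimizing hker hE hcons
    (isEnergyCone_compact hker hE K) hμ (fun n => (hm n).1) fun n => (hm n).2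
  have hKm := hK.measurableSet
  have hbK : b Kᶜ = 0 := by
    have h := hconv.lintegral_le (fun n => (hm n).1.1.1) hb.1
      (hK.isClosed.isOpen_compl.lowerSemicontinuous_indicator zero_le_one :
        LowerSemicontinuous (indicator Kᶜ fun _ => (1 : ℝ≥0∞))) (c := 0) fun n => by
          rw [lintegral_indicator_const hKm.compl, (hm n).1.2, mul_zero]
    rw [lintegral_indicator_const hKm.compl, one_mul] at h
    exact le_antisymm h zero_le
  have hmeas : ∀ {η ζ : Measure X}, η ∈ Eplus κ → ζ ∈ Eplus κ →
      MeasurableSet (K ∩ {x | pot κ η x < pot κ ζ x}) := fun hη hζ =>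
    hKm.inter (measurableSet_lt (pot_measurable hker hη.1) (pot_measurable hker hζ.1))
  have hae : ∀ {η ζ : Measure X}, b (K ∩ {x | pot κ η x < pot κ ζ x}) = 0 →
      ∀ᵐ x ∂b, pot κ ζ x ≤ pot κ η x := fun {η ζ} h => by
    refine ae_iff.2 (measure_mono_null (fun x hx => ?_) (measure_union_null h hbK))
    by_cases hxK : x ∈ K
    · exact Or.inl ⟨hxK, not_le.1 hx⟩
    · exact Or.inr hxK
  have hμb : ∀ᵐ x ∂b, pot κ μ x ≤ pot κ b x :=
    hae (measure_eq_zero_of_pot_lt hker hE hμ hb hb (hmeas hb hμ) (fun x hx => hx.2)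
      (hvar _ ⟨Eplus.restrict hb (hmeas hb hμ),
        restrict_compact_compl b (hmeas hb hμ) inter_subset_left⟩))
  have hpot : ∀ᵐ x ∂b, pot κ μ x = pot κ b x :=
    ae_eq_of_ae_le_of_lintegral_le hμb (energy_lt_top hE hb hμ).ne
      (pot_measurable hker hb.1).aemeasurable
      (by rw [energy_comm hker hμ.1 hb.1] at heq; exact heq.ge)
  refine ⟨b, hb, hbK, fun ν hν hνK => gauss_le_of_variational hE hb hν heq
    (hvar ν ⟨hν, hνK⟩), hD b hb μ hμ (hpot.mono fun x hx => hx.ge), fun A hKA ν hν =>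
    hD b hb ν hν.1 ?_⟩
  have hzero := measure_eq_zero_of_innerCap_eq_zero hν.2 (hmeas hν.1 hμ)
    (fun x hx => ⟨hKA hx.1, not_le.2 hx.2⟩) hb
  filter_upwards [hpot, hae hzero] with x h1 h2
  exact h1 ▸ h2

end Existence

/-- Existence of the inner balayage and its basic potential relations. -/
theorem statement0 (κ : X → X → ℝ≥0∞) (hker : IsKernel κ)
    (hE : EnergyPrinciple κ) (hC : Consistent κ) (hD : Domination κ) :
    ∀ μ ∈ Eplus κ, ∀ A : Set X,
      ∃ b : Measure X, IsInnerBal κ A μ b ∧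
        NEOn κ A (fun x => pot κ b x = pot κ μ x) ∧
        (∀ᵐ x ∂b, pot κ b x = pot κ μ x) ∧
        (∀ x, pot κ b x ≤ pot κ μ x) := by
  intro μ hμ A
  have hcone := isEnergyCone_compactly_carried hker hE A
  obtain ⟨a, ha⟩ := exists_gauss_minimizing_seq hE hcone hμ
  choose ha' K hK hKA haK using fun n => (ha n).1
  choose m hm hmK hmin hmμ hmν using fun n => exists_compact_projection hker hE hC hD hμ (hK n)
  obtain ⟨b, hb, hconv, hvar, heq⟩ := exists_vague_limit_of_minimizing hker hE hC hcone hμ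
    (fun n => ⟨hm n, K n, hK n, hKA n, hmK n⟩)
    fun n ν hν => (hmin n (a n) (ha' n) (haK n)).trans ((ha n).2 ν hν)
  have hpot : ∀ x, pot κ b x ≤ pot κ μ x := fun x =>
    hconv.pot_le hker (fun n => (hm n).1) hb.1 fun n => hmμ n x
  have hne : innerCap κ {x | x ∈ A ∧ pot κ b x < pot κ μ x} = 0 := by
    by_contra hne
    obtain ⟨ν, hν, L, hL, hLN, hLν⟩ := exists_compact_of_innerCap_ne_zero hne
    refine hLν (measure_eq_zero_of_pot_lt hker hE hμ hb hν hL.measurableSet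
      (fun x hx => (hLN hx).2) (hvar _ ⟨Eplus.restrict hν hL.measurableSet, L, hL,
        fun x hx => (hLN hx).1, restrict_compact_compl ν hL.measurableSet le_rfl⟩))
  refine ⟨b, ⟨⟨hb, ?_⟩, fun ν hν x => hconv.pot_le hker (fun n => (hm n).1) hb.1
    fun n => hmν n A (hKA n) ν hν x⟩, ?_, ?_, hpot⟩
  · simpa only [NEOn, not_le] using hne
  · simpa only [NEOn, (hpot _).lt_iff_ne] using hne
  · exact ae_eq_of_ae_le_of_lintegral_le (ae_of_all _ hpot) hb.2.ne
      (pot_measurable hker hμ.1).aemeasurable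
      (by rw [energy_comm hker hμ.1 hb.1] at heq; exact heq.le)

end Balayage
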